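/- Let G and H be countable groups and let A be a common finite subgroup of G and H. Suppose there exist a countable G-set X and a countable H-set Y such that: (i) the G-action on X is transitive; (ii) for every g ∈ G∖A the set {x ∈ X : A·x ∩ gA·x = ∅} is infinite, and for every h ∈ H∖A the set {y ∈ Y : A·y ∩ hA·y = ∅} is infinite; (iii) there exist Følner sequences {C_n} for the G-action on X and {D_n} for the H-action on Y such that |C_n| = |D_n| for all n ≥ 1, and such that the sets {A·C_n}_{n≥1} are pairwise disjoint and the sets {A·D_n}_{n≥1} are pairwise disjoint; and (iv) the restricted actions of A on X and on Y are free. Then the amalgamated free product G ∗_A H belongs to the class 𝒜. -/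

import Mathlib

/-- A `G`-invariant mean on `X`, for the `G`-action on `X` given by `φ`:
a finitely additive probability "measure" on the subsets of `X` invariant under `G`. -/
def IsInvariantMean {G X : Type*} [Group G] (φ : G →* Equiv.Perm X)
    (μ : Set X → ℝ) : Prop :=
  (∀ S : Set X, 0 ≤ μ S) ∧ μ Set.univ = 1 ∧
  (∀ S T : Set X, Disjoint S T → μ (S ∪ T) = μ S + μ T) ∧
  (∀ (g : G) (S : Set X), μ ((φ g) '' S) = μ S)

/-- The action of `G` on `X` given by `φ` is amenable: there is a `G`-invariant mean on `X`. -/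
def AmenableAction {G X : Type*} [Group G] (φ : G →* Equiv.Perm X) : Prop :=
  ∃ μ : Set X → ℝ, IsInvariantMean φ μ

/-- A group is amenable if its left-translation action on itself is amenable. -/
def AmenableGroup (G : Type*) [Group G] : Prop :=
  AmenableAction (MulAction.toPermHom G G)

/-- A group `G` is in the class `𝒜` if it admits a transitive, faithful and
amenable action on some countable set. -/
def InClassA (G : Type*) [Group G] : Prop :=
  ∃ (X : Type) (_ : Countable X) (φ : G →* Equiv.Perm X),
    Function.Injective φ ∧ (∀ x y : X, ∃ g : G, φ g x = y) ∧ AmenableAction φ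

/-- `(P, jG, jH)` is the amalgamated free product of `G` and `H` over `A`
(along the homomorphisms `iG : A →* G` and `iH : A →* H`), i.e. it is a pushout
of `iG` and `iH` in the category of groups. -/
def IsAmalgamatedProduct {A G H P : Type*} [Group A] [Group G] [Group H] [Group P]
    (iG : A →* G) (iH : A →* H) (jG : G →* P) (jH : H →* P) : Prop :=
  jG.comp iG = jH.comp iH ∧
  ∀ (L : Type) [Group L] (fG : G →* L) (fH : H →* L),
    fG.comp iG = fH.comp iH → ∃! f : P →* L, f.comp jG = fG ∧ f.comp jH = fH

/-- A Følner sequence for the action of `G` on `X` given by `φ`: a sequence of finite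
non-empty subsets `C n` of `X` with `|C n △ g • C n| / |C n| → 0` for every `g : G`. -/
def IsFolnerSeq {G X : Type*} [Group G] (φ : G →* Equiv.Perm X) (C : ℕ → Set X) : Prop :=
  (∀ n, (C n).Finite ∧ (C n).Nonempty) ∧
  ∀ g : G, Filter.Tendsto
    (fun n => ((symmDiff (C n) ((φ g) '' C n)).ncard : ℝ) / ((C n).ncard : ℝ))
    Filter.atTop (nhds 0)

section PartialEquivariant

variable {A X Y : Type*} [Group A] (α : A →* Equiv.Perm X) (β : A →* Equiv.Perm Y)

/-- A finite relation between two `A`-sets which is the graph of an `A`-equivariant bijection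
between `A`-invariant subsets. -/
structure IsPartialEquivariant (R : Set (X × Y)) : Prop where
  finite : R.Finite
  smul_mem : ∀ (a : A) {x : X} {y : Y}, (x, y) ∈ R → (α a x, β a y) ∈ R
  eq_right : ∀ {x : X} {y y' : Y}, (x, y) ∈ R → (x, y') ∈ R → y = y'
  eq_left : ∀ {x x' : X} {y : Y}, (x, y) ∈ R → (x', y) ∈ R → x = x'

variable {α β}

theorem IsPartialEquivariant.smul_mem_dom_iff {R : Set (X × Y)}
    (hR : IsPartialEquivariant α β R) (a : A) {x : X} :
    α a x ∈ Prod.fst '' R ↔ x ∈ Prod.fst '' R := by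
  simp only [Set.mem_image, Prod.exists, exists_and_right, exists_eq_right]
  constructor
  · rintro ⟨y, hy⟩
    exact ⟨β a⁻¹ y, by simpa using hR.smul_mem a⁻¹ hy⟩
  · rintro ⟨y, hy⟩
    exact ⟨β a y, hR.smul_mem a hy⟩

theorem IsPartialEquivariant.smul_mem_ran_iff {R : Set (X × Y)}
    (hR : IsPartialEquivariant α β R) (a : A) {y : Y} :
    β a y ∈ Prod.snd '' R ↔ y ∈ Prod.snd '' R := by
  simp only [Set.mem_image, Prod.exists, exists_eq_right]
  constructor
  · rintro ⟨x, hx⟩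
    exact ⟨α a⁻¹ x, by simpa using hR.smul_mem a⁻¹ hx⟩
  · rintro ⟨x, hx⟩
    exact ⟨α a x, hR.smul_mem a hx⟩

variable (α β) in
/-- Adjoin to a relation the orbit of a pair under the diagonal action. -/
def insertOrbit (R : Set (X × Y)) (x : X) (y : Y) : Set (X × Y) :=
  R ∪ Set.range fun a : A => (α a x, β a y)

theorem mem_insertOrbit (R : Set (X × Y)) (x : X) (y : Y) : (x, y) ∈ insertOrbit α β R x y :=
  Or.inr ⟨1, by simp⟩

theorem notMem_dom_insertOrbit {R : Set (X × Y)} {x x' : X} {y : Y}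
    (h : x' ∉ Prod.fst '' R) (h' : ∀ a, α a x ≠ x') :
    x' ∉ Prod.fst '' insertOrbit α β R x y := by
  rintro ⟨⟨u, v⟩, huv | ⟨a, ha⟩, rfl⟩
  · exact h ⟨_, huv, rfl⟩
  · exact h' a (congrArg Prod.fst ha)

theorem notMem_ran_insertOrbit {R : Set (X × Y)} {x : X} {y y' : Y}
    (h : y' ∉ Prod.snd '' R) (h' : ∀ a, β a y ≠ y') :
    y' ∉ Prod.snd '' insertOrbit α β R x y := by
  rintro ⟨⟨u, v⟩, huv | ⟨a, ha⟩, rfl⟩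
  · exact h ⟨_, huv, rfl⟩
  · exact h' a (congrArg Prod.snd ha)

theorem eq_of_apply_eq_of_free {Z : Type*} {γ : A →* Equiv.Perm Z}
    (hγ : ∀ (a : A) (z : Z), γ a z = z → a = 1) {a b : A} {z : Z} (h : γ a z = γ b z) :
    a = b := by
  have := hγ (b⁻¹ * a) z (by simp [h])
  rw [inv_mul_eq_one] at this
  exact this.symm

theorem IsPartialEquivariant.insertOrbit [Finite A] {R : Set (X × Y)}
    (hR : IsPartialEquivariant α β R)
    (hα : ∀ (a : A) (x : X), α a x = x → a = 1) (hβ : ∀ (a : A) (y : Y), β a y = y → a = 1)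
    {x : X} {y : Y} (hx : x ∉ Prod.fst '' R) (hy : y ∉ Prod.snd '' R) :
    IsPartialEquivariant α β (insertOrbit α β R x y) where
  finite := hR.finite.union (Set.finite_range _)
  smul_mem := by
    rintro b u v (h | ⟨a, h⟩)
    · exact Or.inl (hR.smul_mem b h)
    · obtain ⟨rfl, rfl⟩ := Prod.ext_iff.1 h
      exact Or.inr ⟨b * a, by simp⟩
  eq_right := by
    rintro u v v' (h | ⟨a, h⟩) (h' | ⟨a', h'⟩)
    · exact hR.eq_right h h'
    · obtain ⟨rfl, rfl⟩ := Prod.ext_iff.1 h'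
      exact absurd ((hR.smul_mem_dom_iff a').1 ⟨_, h, rfl⟩) hx
    · obtain ⟨rfl, rfl⟩ := Prod.ext_iff.1 h
      exact absurd ((hR.smul_mem_dom_iff a).1 ⟨_, h', rfl⟩) hx
    · obtain ⟨rfl, rfl⟩ := Prod.ext_iff.1 h
      obtain ⟨e, rfl⟩ := Prod.ext_iff.1 h'
      rw [eq_of_apply_eq_of_free hα e]
  eq_left := by
    rintro u u' v (h | ⟨a, h⟩) (h' | ⟨a', h'⟩)
    · exact hR.eq_left h h'
    · obtain ⟨rfl, rfl⟩ := Prod.ext_iff.1 h'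
      exact absurd ((hR.smul_mem_ran_iff a').1 ⟨_, h, rfl⟩) hy
    · obtain ⟨rfl, rfl⟩ := Prod.ext_iff.1 h
      exact absurd ((hR.smul_mem_ran_iff a).1 ⟨_, h', rfl⟩) hy
    · obtain ⟨rfl, rfl⟩ := Prod.ext_iff.1 h
      obtain ⟨rfl, e⟩ := Prod.ext_iff.1 h'
      rw [eq_of_apply_eq_of_free hβ e]

/-- A finite invariant set on one side can be matched into one on the other side, in one of the
two directions. -/
theorem IsPartialEquivariant.exists_matching [Finite A] {R : Set (X × Y)}
    (hR : IsPartialEquivariant α β R)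
    (hα : ∀ (a : A) (x : X), α a x = x → a = 1) (hβ : ∀ (a : A) (y : Y), β a y = y → a = 1)
    {E : Set X} {F : Set Y} (hE : E.Finite) (hF : F.Finite)
    (hEinv : ∀ a, ∀ x ∈ E, α a x ∈ E) (hFinv : ∀ a, ∀ y ∈ F, β a y ∈ F)
    (hEdom : Disjoint E (Prod.fst '' R)) (hFran : Disjoint F (Prod.snd '' R)) :
    ∃ S, IsPartialEquivariant α β S ∧ R ⊆ S ∧
      ((∀ x ∈ E, ∃ y ∈ F, (x, y) ∈ S) ∨ (∀ y ∈ F, ∃ x ∈ E, (x, y) ∈ S)) := by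
  have hfin : {S | IsPartialEquivariant α β S ∧ R ⊆ S ∧ S ⊆ R ∪ E ×ˢ F}.Finite :=
    ((hR.finite.union (hE.prod hF)).finite_subsets).subset fun S hS => hS.2.2
  obtain ⟨S, hS⟩ := hfin.exists_maximal ⟨R, hR, subset_rfl, Set.subset_union_left⟩
  obtain ⟨hS1, hRS, hSR⟩ := hS.prop
  refine ⟨S, hS1, hRS, ?_⟩
  by_contra! hcon
  obtain ⟨⟨x, hxE, hx⟩, ⟨y, hyF, hy⟩⟩ := hcon
  have hx' : x ∉ Prod.fst '' S := by
    rintro ⟨⟨u, v⟩, huv, rfl⟩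
    rcases hSR huv with h | h
    · exact Set.disjoint_left.1 hEdom hxE ⟨_, h, rfl⟩
    · exact hx v h.2 huv
  have hy' : y ∉ Prod.snd '' S := by
    rintro ⟨⟨u, v⟩, huv, rfl⟩
    rcases hSR huv with h | h
    · exact Set.disjoint_left.1 hFran hyF ⟨_, h, rfl⟩
    · exact hy u h.1 huv
  have hsub : _root_.insertOrbit α β S x y ⊆ R ∪ E ×ˢ F := by
    refine Set.union_subset hSR ?_
    rintro _ ⟨a, rfl⟩
    exact Or.inr ⟨hEinv a x hxE, hFinv a y hyF⟩
  have := hS.le_of_ge ⟨hS1.insertOrbit hα hβ hx' hy', hRS.trans Set.subset_union_left, hsub⟩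
    Set.subset_union_left
  exact hx' ⟨_, this (mem_insertOrbit S x y), rfl⟩

/-- An `A`-equivariant bijection between free `A`-sets meeting countably many
prescribed dense sets of finite approximations. -/
theorem exists_equivariant_equiv [Finite A] [Countable X] [Countable Y] [Infinite X] [Infinite Y]
    (hα : ∀ (a : A) (x : X), α a x = x → a = 1) (hβ : ∀ (a : A) (y : Y), β a y = y → a = 1)
    {ι : Type*} [Countable ι] (D : ι → Set (X × Y) → Prop)
    (hD : ∀ i R, IsPartialEquivariant α β R →
      ∃ S, IsPartialEquivariant α β S ∧ R ⊆ S ∧ D i S) :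
    ∃ f : X ≃ Y, (∀ a x, f (α a x) = β a (f x)) ∧
      ∀ i, ∃ S, IsPartialEquivariant α β S ∧ D i S ∧ ∀ x y, (x, y) ∈ S → f x = y := by
  let Q := {R : Set (X × Y) // IsPartialEquivariant α β R}
  have hdom : ∀ x, IsCofinal {R : Q | x ∈ Prod.fst '' R.1} := by
    intro x R
    by_cases hx : x ∈ Prod.fst '' R.1
    · exact ⟨R, hx, le_rfl⟩
    · obtain ⟨y, hy⟩ := (R.2.finite.image Prod.snd).exists_notMem
      exact ⟨⟨_, R.2.insertOrbit hα hβ hx hy⟩, ⟨_, mem_insertOrbit _ _ _, rfl⟩,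
        Set.subset_union_left⟩
  have hran : ∀ y, IsCofinal {R : Q | y ∈ Prod.snd '' R.1} := by
    intro y R
    by_cases hy : y ∈ Prod.snd '' R.1
    · exact ⟨R, hy, le_rfl⟩
    · obtain ⟨x, hx⟩ := (R.2.finite.image Prod.fst).exists_notMem
      exact ⟨⟨_, R.2.insertOrbit hα hβ hx hy⟩, ⟨_, mem_insertOrbit _ _ _, rfl⟩,
        Set.subset_union_left⟩
  have hD' : ∀ i, IsCofinal {R : Q | D i R.1} := by
    intro i R
    obtain ⟨S, hS, hRS, hDS⟩ := hD i R.1 R.2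
    exact ⟨⟨S, hS⟩, hDS, hRS⟩
  let 𝒟 : (X ⊕ Y) ⊕ ι → Order.Cofinal Q :=
    Sum.elim (Sum.elim (fun x => ⟨_, hdom x⟩) fun y => ⟨_, hran y⟩) fun i => ⟨_, hD' i⟩
  have := Encodable.ofCountable ((X ⊕ Y) ⊕ ι)
  let R₀ : Q := ⟨∅, by constructor <;> simp⟩
  let I := Order.idealOfCofinals R₀ 𝒟
  have hI := Order.cofinal_meets_idealOfCofinals R₀ 𝒟
  have hdir : ∀ R ∈ I, ∀ S ∈ I, ∃ T ∈ I, R ≤ T ∧ S ≤ T := I.directed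
  have h1 : ∀ x, ∃ y, ∃ R ∈ I, (x, y) ∈ R.1 := by
    intro x
    obtain ⟨R, ⟨⟨u, v⟩, huv, rfl⟩, hR⟩ := hI (Sum.inl (Sum.inl x))
    exact ⟨v, R, hR, huv⟩
  have h2 : ∀ y, ∃ x, ∃ R ∈ I, (x, y) ∈ R.1 := by
    intro y
    obtain ⟨R, ⟨⟨u, v⟩, huv, rfl⟩, hR⟩ := hI (Sum.inl (Sum.inr y))
    exact ⟨u, R, hR, huv⟩
  choose f hf using h1
  choose g hg using h2
  have hfun : ∀ R ∈ I, ∀ x y, (x, y) ∈ R.1 → f x = y := by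
    intro R hR x y hxy
    obtain ⟨S, hS, hxS⟩ := hf x
    obtain ⟨T, -, hRT, hST⟩ := hdir R hR S hS
    exact T.2.eq_right (hST hxS) (hRT hxy)
  have hgf : ∀ R ∈ I, ∀ x y, (x, y) ∈ R.1 → g y = x := by
    intro R hR x y hxy
    obtain ⟨S, hS, hxS⟩ := hg y
    obtain ⟨T, -, hRT, hST⟩ := hdir R hR S hS
    exact T.2.eq_left (hST hxS) (hRT hxy)
  refine ⟨⟨f, g, fun x => ?_, fun y => ?_⟩, fun a x => ?_, fun i => ?_⟩
  · obtain ⟨R, hR, h⟩ := hf x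
    exact hgf R hR _ _ h
  · obtain ⟨R, hR, h⟩ := hg y
    exact hfun R hR _ _ h
  · obtain ⟨R, hR, h⟩ := hf x
    exact hfun R hR _ _ (R.2.smul_mem a h)
  · obtain ⟨R, hDR, hR⟩ := hI (Sum.inr i)
    exact ⟨R.1, R.2, hDR, hfun R hR⟩

end PartialEquivariant

section Amalgam

variable {A G H P : Type*} [Group A] [Group G] [Group H] [Group P]

/-- `IsReducedProduct iG iH jG jH b p` means that `p` is a nonempty alternating product of images
of elements of `G ∖ A` and of `H ∖ A`, with leftmost letter from `G` if `b = true` and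
from `H` if `b = false`. -/
inductive IsReducedProduct (iG : A →* G) (iH : A →* H) (jG : G →* P) (jH : H →* P) :
    Bool → P → Prop
  | left (g : G) : g ∉ Set.range iG → IsReducedProduct iG iH jG jH true (jG g)
  | right (h : H) : h ∉ Set.range iH → IsReducedProduct iG iH jG jH false (jH h)
  | left_mul (g : G) (p : P) : g ∉ Set.range iG → IsReducedProduct iG iH jG jH false p →
      IsReducedProduct iG iH jG jH true (jG g * p)
  | right_mul (h : H) (p : P) : h ∉ Set.range iH → IsReducedProduct iG iH jG jH true p →
      IsReducedProduct iG iH jG jH false (jH h * p)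

variable {iG : A →* G} {iH : A →* H} {jG : G →* P} {jH : H →* P}

theorem notMem_range_mul_left {K : Type*} [Group K] {i : A →* K} {k : K}
    (hk : k ∉ Set.range i) (a : A) : i a * k ∉ Set.range i := by
  rintro ⟨b, hb⟩
  exact hk ⟨a⁻¹ * b, by simp [hb]⟩

theorem notMem_range_mul_right {K : Type*} [Group K] {i : A →* K} {k : K}
    (hk : k ∉ Set.range i) (a : A) : k * i a ∉ Set.range i := by
  rintro ⟨b, hb⟩
  exact hk ⟨b * a⁻¹, by simp [hb]⟩

theorem IsReducedProduct.base_mul (hj : ∀ a, jG (iG a) = jH (iH a)) {b : Bool} {p : P}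
    (hp : IsReducedProduct iG iH jG jH b p) (a : A) :
    IsReducedProduct iG iH jG jH b (jG (iG a) * p) := by
  cases hp with
  | left g hg => rw [← map_mul]; exact .left _ (notMem_range_mul_left hg a)
  | right h hh => rw [hj, ← map_mul]; exact .right _ (notMem_range_mul_left hh a)
  | left_mul g p hg hp =>
    rw [← mul_assoc, ← map_mul]; exact .left_mul _ _ (notMem_range_mul_left hg a) hp
  | right_mul h p hh hp =>
    rw [hj, ← mul_assoc, ← map_mul]; exact .right_mul _ _ (notMem_range_mul_left hh a) hp

theorem mem_base_or_isReducedProduct_left_mul (hj : ∀ a, jG (iG a) = jH (iH a)) (g : G) {p : P}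
    (hp : (∃ a, p = jG (iG a)) ∨ ∃ b, IsReducedProduct iG iH jG jH b p) :
    (∃ a, jG g * p = jG (iG a)) ∨ ∃ b, IsReducedProduct iG iH jG jH b (jG g * p) := by
  by_cases hg : g ∈ Set.range iG
  · obtain ⟨a, rfl⟩ := hg
    rcases hp with ⟨a', rfl⟩ | ⟨b, hp⟩
    · exact Or.inl ⟨a * a', by simp⟩
    · exact Or.inr ⟨b, hp.base_mul hj a⟩
  rcases hp with ⟨a, rfl⟩ | ⟨b, hp⟩
  · rw [← map_mul]
    exact Or.inr ⟨_, .left _ (notMem_range_mul_right hg a)⟩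
  have key : ∀ g', (g * g' ∈ Set.range iG → ∃ a, jG g * jG g' = jG (iG a)) := by
    rintro g' ⟨a, ha⟩
    exact ⟨a, by rw [ha, map_mul]⟩
  cases hp with
  | left g' hg' =>
    by_cases hgg : g * g' ∈ Set.range iG
    · exact Or.inl (key g' hgg)
    · rw [← map_mul]; exact Or.inr ⟨_, .left _ hgg⟩
  | right h hh => exact Or.inr ⟨_, .left_mul _ _ hg (.right h hh)⟩
  | left_mul g' p hg' hp =>
    rw [← mul_assoc]
    by_cases hgg : g * g' ∈ Set.range iG
    · obtain ⟨a, ha⟩ := key g' hgg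
      rw [ha]
      exact Or.inr ⟨_, hp.base_mul hj a⟩
    · rw [← map_mul]; exact Or.inr ⟨_, .left_mul _ _ hgg hp⟩
  | right_mul h p hh hp => exact Or.inr ⟨_, .left_mul _ _ hg (.right_mul h p hh hp)⟩

theorem IsReducedProduct.swap {b : Bool} {p : P} (hp : IsReducedProduct iG iH jG jH b p) :
    IsReducedProduct iH iG jH jG (!b) p := by
  induction hp with
  | left g hg => exact .right g hg
  | right h hh => exact .left h hh
  | left_mul g p hg _ ih => exact .right_mul g p hg ih
  | right_mul h p hh _ ih => exact .left_mul h p hh ih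

theorem mem_base_or_isReducedProduct_right_mul (hj : ∀ a, jG (iG a) = jH (iH a)) (h : H) {p : P}
    (hp : (∃ a, p = jG (iG a)) ∨ ∃ b, IsReducedProduct iG iH jG jH b p) :
    (∃ a, jH h * p = jG (iG a)) ∨ ∃ b, IsReducedProduct iG iH jG jH b (jH h * p) := by
  simp only [hj] at hp ⊢
  exact (mem_base_or_isReducedProduct_left_mul (fun a => (hj a).symm) h
    (hp.imp_right fun ⟨_, hb⟩ => ⟨_, hb.swap⟩)).imp_right fun ⟨_, hb⟩ => ⟨_, hb.swap⟩

end Amalgam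

section Generation

variable {A G H P : Type} [Group A] [Group G] [Group H] [Group P]
  {iG : A →* G} {iH : A →* H} {jG : G →* P} {jH : H →* P}

theorem IsAmalgamatedProduct.comm (hP : IsAmalgamatedProduct iG iH jG jH) (a : A) :
    jG (iG a) = jH (iH a) :=
  DFunLike.congr_fun hP.1 a

theorem IsAmalgamatedProduct.eq_top (hP : IsAmalgamatedProduct iG iH jG jH) {S : Subgroup P}
    (hG : ∀ g, jG g ∈ S) (hH : ∀ h, jH h ∈ S) : S = ⊤ := by
  obtain ⟨f, ⟨hfG, hfH⟩, -⟩ := hP.2 S (jG.codRestrict S hG) (jH.codRestrict S hH)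
    (MonoidHom.ext fun a => Subtype.ext (hP.comm a))
  have hid : S.subtype.comp f = MonoidHom.id P := by
    refine (hP.2 P jG jH hP.1).unique ⟨?_, ?_⟩ ⟨rfl, rfl⟩
    · rw [MonoidHom.comp_assoc, hfG]; rfl
    · rw [MonoidHom.comp_assoc, hfH]; rfl
  refine eq_top_iff.2 fun p _ => ?_
  have := DFunLike.congr_fun hid p
  rw [← show S.subtype (f p) = p from this]
  exact (f p).2

theorem IsAmalgamatedProduct.induction (hP : IsAmalgamatedProduct iG iH jG jH)
    {motive : P → Prop} (one : motive 1) (left : ∀ g p, motive p → motive (jG g * p))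
    (right : ∀ h p, motive p → motive (jH h * p)) (p : P) : motive p := by
  have htop : Subgroup.closure (Set.range jG ∪ Set.range jH) = ⊤ :=
    hP.eq_top (fun g => Subgroup.subset_closure (Or.inl ⟨g, rfl⟩))
      fun h => Subgroup.subset_closure (Or.inr ⟨h, rfl⟩)
  have hp : p ∈ Subgroup.closure (Set.range jG ∪ Set.range jH) := htop ▸ Subgroup.mem_top p
  induction hp using Subgroup.closure_induction_left with
  | one => exact one
  | mul_left x hx y _ ih =>
    rcases hx with ⟨g, rfl⟩ | ⟨h, rfl⟩
    · exact left g y ih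
    · exact right h y ih
  | inv_mul_cancel x hx y _ ih =>
    rcases hx with ⟨g, rfl⟩ | ⟨h, rfl⟩
    · rw [← map_inv]; exact left _ y ih
    · rw [← map_inv]; exact right _ y ih

theorem IsAmalgamatedProduct.countable [Countable G] [Countable H]
    (hP : IsAmalgamatedProduct iG iH jG jH) : Countable P := by
  have hsurj : Function.Surjective
      fun l : List (G ⊕ H) => (l.map (Sum.elim jG jH)).prod := by
    intro p
    induction p using hP.induction with
    | one => exact ⟨[], rfl⟩
    | left g p ih =>
      obtain ⟨l, rfl⟩ := ih
      exact ⟨Sum.inl g :: l, by simp⟩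
    | right h p ih =>
      obtain ⟨l, rfl⟩ := ih
      exact ⟨Sum.inr h :: l, by simp⟩
  exact hsurj.countable

theorem IsAmalgamatedProduct.mem_base_or_isReducedProduct
    (hP : IsAmalgamatedProduct iG iH jG jH) (p : P) :
    (∃ a, p = jG (iG a)) ∨ ∃ b, IsReducedProduct iG iH jG jH b p := by
  induction p using hP.induction with
  | one => exact Or.inl ⟨1, by simp⟩
  | left g p ih => exact mem_base_or_isReducedProduct_left_mul hP.comm g ih
  | right h p ih => exact mem_base_or_isReducedProduct_right_mul hP.comm h ih

end Generation

section Faithfulness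

variable {A G H P X Y : Type*} [Group A] [Group G] [Group H] [Group P]
  {iG : A →* G} {iH : A →* H} {jG : G →* P} {jH : H →* P}
  {φ : G →* Equiv.Perm X} {ψ : H →* Equiv.Perm Y}

/-- An infinite set of points displaced off their own orbit contains points which, together with
their translate, avoid a given finite set. -/
theorem exists_displaced_notMem {i : A →* G} {g : G} {K : Set X} (hK : K.Finite)
    (hsupp : {x : X | ∀ a b : A, φ (i a) x ≠ φ g (φ (i b) x)}.Infinite) :
    ∃ x, x ∉ K ∧ φ g x ∉ K ∧ ∀ a, φ (i a) x ≠ φ g x := by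
  obtain ⟨x, hx, hxK⟩ := hsupp.exists_notMem_finite
    (hK.union (hK.preimage (φ g).injective.injOn))
  refine ⟨x, fun h => hxK (Or.inl h), fun h => hxK (Or.inr h), fun a => ?_⟩
  simpa using hx a 1

variable (jG jH φ ψ) in
/-- The action `π` of `P` on `X` restricts to `φ` on `G` and to the transport of `ψ` along `f`
on `H`. -/
structure IsGluedAction (f : X ≃ Y) (π : P →* Equiv.Perm X) : Prop where
  left : ∀ g x, π (jG g) x = φ g x
  right : ∀ h x, f (π (jH h) x) = ψ h (f x)

variable (jG jH φ ψ) in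
/-- `S` forces `p` to send some point of its domain outside of its domain, whichever
bijection extending `S` is used to glue the actions. -/
def ForcesOutOfDomain (p : P) (S : Set (X × Y)) : Prop :=
  ∃ x ∈ Prod.fst '' S, ∃ z ∉ Prod.fst '' S, ∀ (f : X ≃ Y) (π : P →* Equiv.Perm X),
    IsGluedAction jG jH φ ψ f π → (∀ x y, (x, y) ∈ S → f x = y) → π p x = z

variable (jG jH φ ψ) in
/-- `S` forces `p` to send some point of its domain to a point with image outside of its range,
whichever bijection extending `S` is used to glue the actions. -/
def ForcesOutOfRange (p : P) (S : Set (X × Y)) : Prop :=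
  ∃ x ∈ Prod.fst '' S, ∃ z ∉ Prod.snd '' S, ∀ (f : X ≃ Y) (π : P →* Equiv.Perm X),
    IsGluedAction jG jH φ ψ f π → (∀ x y, (x, y) ∈ S → f x = y) → f (π p x) = z

theorem ForcesOutOfDomain.ne_one {p : P} {S : Set (X × Y)}
    (h : ForcesOutOfDomain jG jH φ ψ p S) {f : X ≃ Y} {π : P →* Equiv.Perm X}
    (hπ : IsGluedAction jG jH φ ψ f π) (hf : ∀ x y, (x, y) ∈ S → f x = y) : π p ≠ 1 := by
  obtain ⟨x, hx, z, hz, hxz⟩ := h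
  intro hp
  have := hxz f π hπ hf
  rw [hp, Equiv.Perm.one_apply] at this
  exact hz (this ▸ hx)

theorem ForcesOutOfRange.ne_one {p : P} {S : Set (X × Y)}
    (h : ForcesOutOfRange jG jH φ ψ p S) {f : X ≃ Y} {π : P →* Equiv.Perm X}
    (hπ : IsGluedAction jG jH φ ψ f π) (hf : ∀ x y, (x, y) ∈ S → f x = y) : π p ≠ 1 := by
  obtain ⟨_, ⟨⟨x, y⟩, hx, rfl⟩, z, hz, hxz⟩ := h
  intro hp
  have := hxz f π hπ hf
  rw [hp, Equiv.Perm.one_apply, hf x y hx] at this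
  exact hz ⟨_, hx, this⟩

/-- Every finite partial equivariant bijection extends to one forcing a given reduced product
to act nontrivially. -/
theorem IsReducedProduct.exists_forces [Finite A] [Infinite X] [Infinite Y]
    (hsuppG : ∀ g : G, g ∉ Set.range iG →
      {x : X | ∀ a b : A, φ (iG a) x ≠ φ g (φ (iG b) x)}.Infinite)
    (hsuppH : ∀ h : H, h ∉ Set.range iH →
      {y : Y | ∀ a b : A, ψ (iH a) y ≠ ψ h (ψ (iH b) y)}.Infinite)
    (hfreeX : ∀ (a : A) (x : X), φ (iG a) x = x → a = 1)
    (hfreeY : ∀ (a : A) (y : Y), ψ (iH a) y = y → a = 1)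
    {b : Bool} {p : P} (hp : IsReducedProduct iG iH jG jH b p)
    {R : Set (X × Y)} (hR : IsPartialEquivariant (φ.comp iG) (ψ.comp iH) R) :
    ∃ S, IsPartialEquivariant (φ.comp iG) (ψ.comp iH) S ∧ R ⊆ S ∧
      (b = true → ForcesOutOfDomain jG jH φ ψ p S) ∧
      (b = false → ForcesOutOfRange jG jH φ ψ p S) := by
  induction hp with
  | left g hg =>
    obtain ⟨x, hx, hgx, hne⟩ :=
      exists_displaced_notMem (hR.finite.image Prod.fst) (hsuppG g hg)
    obtain ⟨y, hy⟩ := (hR.finite.image Prod.snd).exists_notMem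
    refine ⟨_, hR.insertOrbit hfreeX hfreeY hx hy, Set.subset_union_left, fun _ => ?_, nofun⟩
    exact ⟨x, ⟨_, mem_insertOrbit R x y, rfl⟩, φ g x, notMem_dom_insertOrbit hgx hne,
      fun f π hπ hf => hπ.left g x⟩
  | right h hh =>
    obtain ⟨y, hy, hhy, hne⟩ :=
      exists_displaced_notMem (hR.finite.image Prod.snd) (hsuppH h hh)
    obtain ⟨x, hx⟩ := (hR.finite.image Prod.fst).exists_notMem
    refine ⟨_, hR.insertOrbit hfreeX hfreeY hx hy, Set.subset_union_left, nofun, fun _ => ?_⟩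
    refine ⟨x, ⟨_, mem_insertOrbit R x y, rfl⟩, ψ h y, notMem_ran_insertOrbit hhy hne,
      fun f π hπ hf => ?_⟩
    rw [hπ.right, hf _ _ (mem_insertOrbit R x y)]
  | left_mul g p hg _ ih =>
    obtain ⟨S, hS, hRS, -, hpS⟩ := ih
    obtain ⟨x₀, hx₀, z, hz, hxz⟩ := hpS rfl
    obtain ⟨x, hx, hgx, hne⟩ :=
      exists_displaced_notMem (hS.finite.image Prod.fst) (hsuppG g hg)
    refine ⟨_, hS.insertOrbit hfreeX hfreeY hx hz, hRS.trans Set.subset_union_left,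
      fun _ => ?_, nofun⟩
    refine ⟨x₀, Set.image_mono Set.subset_union_left hx₀, φ g x,
      notMem_dom_insertOrbit hgx hne, fun f π hπ hf => ?_⟩
    have h1 := hxz f π hπ fun x y hxy => hf x y (Or.inl hxy)
    have h2 := hf _ _ (mem_insertOrbit S x z)
    rw [map_mul, Equiv.Perm.mul_apply, hπ.left, f.injective (h1.trans h2.symm)]
  | right_mul h p hh _ ih =>
    obtain ⟨S, hS, hRS, hpS, -⟩ := ih
    obtain ⟨x₀, hx₀, z, hz, hxz⟩ := hpS rfl
    obtain ⟨y, hy, hhy, hne⟩ :=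
      exists_displaced_notMem (hS.finite.image Prod.snd) (hsuppH h hh)
    refine ⟨_, hS.insertOrbit hfreeX hfreeY hz hy, hRS.trans Set.subset_union_left,
      nofun, fun _ => ?_⟩
    refine ⟨x₀, Set.image_mono Set.subset_union_left hx₀, ψ h y,
      notMem_ran_insertOrbit hhy hne, fun f π hπ hf => ?_⟩
    rw [map_mul, Equiv.Perm.mul_apply, hπ.right,
      hxz f π hπ fun x y hxy => hf x y (Or.inl hxy), hf _ _ (mem_insertOrbit S z y)]

end Faithfulness

section Asymptotics

open Filter Topology

variable {X Y : Type*}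

/-- Two sequences of sets whose symmetric difference is negligible relative to `c` along `L`. -/
def AsympEq (L : Filter ℕ) (c : ℕ → ℝ) (S T : ℕ → Set X) : Prop :=
  Tendsto (fun n => ((symmDiff (S n) (T n)).ncard : ℝ) / c n) L (𝓝 0)

variable {L : Filter ℕ} {c : ℕ → ℝ} {S T U : ℕ → Set X}

theorem AsympEq.symm (h : AsympEq L c S T) : AsympEq L c T S := by
  simpa only [AsympEq, symmDiff_comm] using h

theorem AsympEq.mono {L' : Filter ℕ} (h : AsympEq L c S T) (hL : L' ≤ L) : AsympEq L' c S T :=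
  Tendsto.mono_left h hL

theorem AsympEq.of_le_add {Z : Type*} {S' T' : ℕ → Set Y} {S'' T'' : ℕ → Set Z}
    (hc : ∀ n, 0 ≤ c n)
    (h : AsympEq L c S' T') (h' : AsympEq L c S'' T'')
    (hle : ∀ᶠ n in L, (symmDiff (S n) (T n)).ncard ≤
      (symmDiff (S' n) (T' n)).ncard + (symmDiff (S'' n) (T'' n)).ncard) :
    AsympEq L c S T := by
  have := Tendsto.add h h'
  rw [add_zero] at this
  refine tendsto_of_tendsto_of_tendsto_of_le_of_le' tendsto_const_nhds this
    (Eventually.of_forall fun n => div_nonneg (Nat.cast_nonneg _) (hc n)) ?_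
  filter_upwards [hle] with n hn
  rw [← add_div]
  exact div_le_div_of_nonneg_right (mod_cast hn) (hc n)

theorem AsympEq.trans (hc : ∀ n, 0 ≤ c n) (hS : ∀ n, (S n).Finite) (hT : ∀ n, (T n).Finite)
    (hU : ∀ n, (U n).Finite) (h : AsympEq L c S T) (h' : AsympEq L c T U) :
    AsympEq L c S U :=
  .of_le_add hc h h' <| Eventually.of_forall fun n =>
    (Set.ncard_le_ncard (symmDiff_triangle _ _ _)
      (((hS n).symmDiff (hT n)).union ((hT n).symmDiff (hU n)))).trans (Set.ncard_union_le _ _)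

theorem asympEq_image_iff (f : X ≃ Y) :
    AsympEq L c (fun n => f '' S n) (fun n => f '' T n) ↔ AsympEq L c S T := by
  simp only [AsympEq, ← Set.image_symmDiff f.injective, Set.ncard_image_of_injective _ f.injective]

theorem AsympEq.iUnion {ι : Type*} [Finite ι] [Nonempty ι] {T : ι → ℕ → Set X}
    (hc : ∀ n, 0 ≤ c n) (hS : ∀ n, (S n).Finite) (hT : ∀ i n, (T i n).Finite)
    (h : ∀ i, AsympEq L c S (T i)) :
    AsympEq L c S fun n => ⋃ i, T i n := by
  have := Fintype.ofFinite ι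
  have hsum := tendsto_finsetSum Finset.univ fun i _ => h i
  rw [Finset.sum_const_zero] at hsum
  refine squeeze_zero (fun n => div_nonneg (Nat.cast_nonneg _) (hc n)) (fun n => ?_) hsum
  rw [← Finset.sum_div]
  refine div_le_div_of_nonneg_right ?_ (hc n)
  have hsub : symmDiff (S n) (⋃ i, T i n) ⊆ ⋃ i, symmDiff (S n) (T i n) := by
    rintro x (⟨hx, hx'⟩ | ⟨hx, hx'⟩)
    · obtain ⟨i⟩ := ‹Nonempty ι›
      exact Set.mem_iUnion.2 ⟨i, Or.inl ⟨hx, fun h => hx' (Set.mem_iUnion.2 ⟨i, h⟩)⟩⟩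
    · obtain ⟨i, hi⟩ := Set.mem_iUnion.1 hx
      exact Set.mem_iUnion.2 ⟨i, Or.inr ⟨hi, hx'⟩⟩
  have hle := Set.ncard_le_ncard hsub (Set.finite_iUnion fun i => (hS n).symmDiff (hT i n))
  exact_mod_cast hle.trans (Set.ncard_iUnion_le_of_fintype _)

theorem ncard_le_ncard_add_ncard_symmDiff {S T : Set X} (hS : S.Finite) (hT : T.Finite) :
    S.ncard ≤ T.ncard + (symmDiff S T).ncard := by
  refine (Set.ncard_le_ncard ?_ (hT.union (hS.symmDiff hT))).trans (Set.ncard_union_le _ _)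
  intro x hx
  by_cases h : x ∈ T
  · exact Or.inl h
  · exact Or.inr (Or.inl ⟨hx, h⟩)

/-- Two nested finite sets which are close to sets of equal cardinality are close. -/
theorem ncard_symmDiff_le_of_nested {E F C D : Set X}
    (hE : E.Finite) (hF : F.Finite) (hC : C.Finite) (hD : D.Finite)
    (hCD : C.ncard = D.ncard) (hnest : E ⊆ F ∨ F ⊆ E) :
    (symmDiff E F).ncard ≤ (symmDiff C E).ncard + (symmDiff D F).ncard := by
  have h1 := ncard_le_ncard_add_ncard_symmDiff hC hE
  have h2 := ncard_le_ncard_add_ncard_symmDiff hE hC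
  have h3 := ncard_le_ncard_add_ncard_symmDiff hD hF
  have h4 := ncard_le_ncard_add_ncard_symmDiff hF hD
  rw [symmDiff_comm E C] at h2
  rw [symmDiff_comm F D] at h4
  rcases hnest with h | h
  · rw [symmDiff_of_le h]
    have := Set.ncard_sdiff_add_ncard_of_subset h hF
    omega
  · rw [symmDiff_of_ge h]
    have := Set.ncard_sdiff_add_ncard_of_subset h hE
    omega

/-- The limit along an ultrafilter of the densities in an asymptotically invariant sequence of
finite sets is an invariant mean. -/
theorem amenableAction_of_asympEq {P : Type*} [Group P] {π : P →* Equiv.Perm X} {C : ℕ → Set X}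
    (U : Ultrafilter ℕ) (hC : ∀ n, (C n).Finite) (hne : ∀ n, (C n).Nonempty)
    (h : ∀ p, AsympEq U (fun n => ((C n).ncard : ℝ)) C fun n => π p '' C n) :
    AmenableAction π := by
  have hpos : ∀ n, 0 < ((C n).ncard : ℝ) := fun n =>
    Nat.cast_pos.2 ((Set.ncard_pos (hC n)).2 (hne n))
  let d : Set X → ℕ → ℝ := fun S n => ((S ∩ C n).ncard : ℝ) / (C n).ncard
  have hd : ∀ S, ∃ r ∈ Set.Icc (0 : ℝ) 1, Tendsto (d S) U (𝓝 r) := by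
    intro S
    have hmem : ∀ n, d S n ∈ Set.Icc (0 : ℝ) 1 := fun n =>
      ⟨div_nonneg (Nat.cast_nonneg _) (Nat.cast_nonneg _), (div_le_one (hpos n)).2
        (mod_cast Set.ncard_le_ncard Set.inter_subset_right (hC n))⟩
    exact isCompact_Icc.ultrafilter_le_nhds (U.map (d S))
      (le_principal_iff.2 (Filter.mem_map.2 (univ_mem' hmem)))
  choose μ hμ01 hμ using hd
  refine ⟨μ, fun S => (hμ01 S).1, ?_, fun S T hST => ?_, fun p S => ?_⟩
  · refine tendsto_nhds_unique (hμ Set.univ) (tendsto_const_nhds.congr fun n => ?_)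
    simp [d, (hpos n).ne']
  · refine tendsto_nhds_unique (hμ (S ∪ T)) (((hμ S).add (hμ T)).congr fun n => ?_)
    simp only [d]
    rw [← add_div, Set.union_inter_distrib_right, Set.ncard_union_eq
      (hST.mono Set.inter_subset_left Set.inter_subset_left)
      ((hC n).inter_of_right _) ((hC n).inter_of_right _), Nat.cast_add]
  · refine tendsto_nhds_unique (hμ (π p '' S)) ?_
    have hdiff : Tendsto (fun n => d (π p '' S) n - d S n) U (𝓝 0) := by
      refine squeeze_zero_norm (fun n => ?_) (h p)
      have himg : ((π p '' S) ∩ (π p '' C n)).ncard = (S ∩ C n).ncard := by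
        rw [← Set.image_inter (π p).injective, Set.ncard_image_of_injective _ (π p).injective]
      have hfin : (π p '' C n).Finite := (hC n).image _
      have h1 := ncard_le_ncard_add_ncard_symmDiff ((hC n).inter_of_right (π p '' S))
        (hfin.inter_of_right (π p '' S))
      have h2 := ncard_le_ncard_add_ncard_symmDiff (hfin.inter_of_right (π p '' S))
        ((hC n).inter_of_right (π p '' S))
      rw [symmDiff_comm] at h2
      have h3 : (symmDiff (π p '' S ∩ C n) (π p '' S ∩ π p '' C n)).ncard ≤
          (symmDiff (C n) (π p '' C n)).ncard := by
        refine Set.ncard_le_ncard ?_ ((hC n).symmDiff hfin)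
        rintro x (⟨hx, hx'⟩ | ⟨hx, hx'⟩)
        · exact Or.inl ⟨hx.2, fun h => hx' ⟨hx.1, h⟩⟩
        · exact Or.inr ⟨hx.2, fun h => hx' ⟨hx.1, h⟩⟩
      rw [himg] at h1 h2
      simp only [d]
      rw [← sub_div, Real.norm_eq_abs, abs_div, abs_of_pos (hpos n)]
      refine div_le_div_of_nonneg_right (abs_sub_le_iff.2 ⟨?_, ?_⟩) (hpos n).le
      · rw [sub_le_iff_le_add']
        exact_mod_cast h1.trans (Nat.add_le_add_left h3 _)
      · rw [sub_le_iff_le_add']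
        exact_mod_cast h2.trans (Nat.add_le_add_left h3 _)
    simpa using (hdiff.add (hμ S)).congr fun n => sub_add_cancel _ _

end Asymptotics

section Gluing

open Filter Topology

theorem eventually_disjoint_of_pairwise_disjoint {X : Type*} {E : ℕ → Set X}
    (hE : Pairwise fun m n => Disjoint (E m) (E n)) {K : Set X} (hK : K.Finite) :
    ∀ᶠ n in atTop, Disjoint (E n) K := by
  have h : ∀ᶠ n in atTop, ∀ k ∈ K, k ∉ E n := by
    refine (eventually_all_finite hK).2 fun k _ => ?_
    by_cases hk : ∃ m, k ∈ E m
    · obtain ⟨m, hm⟩ := hk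
      filter_upwards [eventually_ne_atTop m] with n hn
      exact Set.disjoint_left.1 (hE hn.symm) hm
    · exact Eventually.of_forall fun n hn => hk ⟨n, hn⟩
  exact h.mono fun n hn => Set.disjoint_right.2 hn

theorem infinite_of_pairwise_disjoint {X : Type*} {E : ℕ → Set X}
    (hE : Pairwise fun m n => Disjoint (E m) (E n)) (hne : ∀ n, (E n).Nonempty) :
    Infinite X := by
  by_contra hfin
  rw [not_infinite_iff_finite] at hfin
  obtain ⟨n, hn⟩ := (eventually_disjoint_of_pairwise_disjoint hE Set.finite_univ).exists
  exact (hne n).ne_empty (Set.disjoint_univ.1 hn)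

/-- The saturation of a set under an action of `A`. -/
def saturation {A X : Type*} [Group A] (α : A →* Equiv.Perm X) (C : Set X) : Set X :=
  ⋃ a : A, α a '' C

theorem saturation_finite {A X : Type*} [Group A] [Finite A] (α : A →* Equiv.Perm X) {C : Set X}
    (hC : C.Finite) : (saturation α C).Finite :=
  Set.finite_iUnion fun _ => hC.image _

theorem saturation_nonempty {A X : Type*} [Group A] (α : A →* Equiv.Perm X) {C : Set X}
    (hC : C.Nonempty) : (saturation α C).Nonempty :=
  Set.nonempty_iUnion.2 ⟨1, hC.image _⟩

theorem apply_mem_saturation {A X : Type*} [Group A] (α : A →* Equiv.Perm X) {C : Set X}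
    (a : A) (x : X) (hx : x ∈ saturation α C) : α a x ∈ saturation α C := by
  obtain ⟨b, y, hy, rfl⟩ := Set.mem_iUnion.1 hx
  exact Set.mem_iUnion.2 ⟨a * b, y, hy, by simp⟩

theorem IsFolnerSeq.asympEq_saturation {A G X : Type*} [Group A] [Group G] [Finite A]
    {φ : G →* Equiv.Perm X} {C : ℕ → Set X} (hC : IsFolnerSeq φ C) (i : A →* G) :
    AsympEq atTop (fun n => ((C n).ncard : ℝ)) C fun n => saturation (φ.comp i) (C n) :=
  AsympEq.iUnion (fun _ => Nat.cast_nonneg _) (fun n => (hC.1 n).1)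
    (fun _ n => (hC.1 n).1.image _) fun a => hC.2 (i a)

/-- A glued action is amenable if the gluing bijection infinitely often nests the saturations of
two Følner sequences of equal cardinalities. -/
theorem amenableAction_of_frequently_nested {A G H P X Y : Type} [Group A] [Group G] [Group H]
    [Group P] [Finite A] {iG : A →* G} {iH : A →* H} {jG : G →* P} {jH : H →* P}
    {φ : G →* Equiv.Perm X} {ψ : H →* Equiv.Perm Y} (hP : IsAmalgamatedProduct iG iH jG jH)
    {f : X ≃ Y} {π : P →* Equiv.Perm X} (hπ : IsGluedAction jG jH φ ψ f π)
    {C : ℕ → Set X} {D : ℕ → Set Y} (hC : IsFolnerSeq φ C) (hD : IsFolnerSeq ψ D)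
    (hCD : ∀ n, (C n).ncard = (D n).ncard)
    (hnest : ∃ᶠ n in atTop,
      f '' saturation (φ.comp iG) (C n) ⊆ saturation (ψ.comp iH) (D n) ∨
      saturation (ψ.comp iH) (D n) ⊆ f '' saturation (φ.comp iG) (C n)) :
    AmenableAction π := by
  obtain ⟨U, hU⟩ := @Ultrafilter.exists_le _ _ (frequently_mem_iff_neBot.1 hnest)
  have hUtop : (U : Filter ℕ) ≤ atTop := hU.trans inf_le_left
  have hUnest := le_principal_iff.1 (hU.trans inf_le_right)
  have hCfin := fun n => (hC.1 n).1
  have hDfin := fun n => (hD.1 n).1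
  have hEfin := fun n => saturation_finite (φ.comp iG) (hCfin n)
  have hFfin := fun n => saturation_finite (ψ.comp iH) (hDfin n)
  have hc : ∀ n, (0 : ℝ) ≤ (C n).ncard := fun _ => Nat.cast_nonneg _
  have hcD : (fun n => ((D n).ncard : ℝ)) = fun n => ((C n).ncard : ℝ) :=
    funext fun n => by rw [hCD]
  have hDF := (hD.asympEq_saturation iH).mono hUtop
  rw [hcD] at hDF
  have hCE := (asympEq_image_iff f).2 ((hC.asympEq_saturation iG).mono hUtop)
  have hEF : AsympEq U (fun n => ((C n).ncard : ℝ))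
      (fun n => f '' saturation (φ.comp iG) (C n)) fun n => saturation (ψ.comp iH) (D n) := by
    refine .of_le_add hc hCE hDF ?_
    filter_upwards [hUnest] with n hn
    refine ncard_symmDiff_le_of_nested ((hEfin n).image f) (hFfin n) ((hCfin n).image f)
      (hDfin n) ?_ hn
    rw [Set.ncard_image_of_injective _ f.injective, hCD]
  have hfCD : AsympEq U (fun n => ((C n).ncard : ℝ)) (fun n => f '' C n) D :=
    (hCE.trans hc (fun n => (hCfin n).image f) (fun n => (hEfin n).image f) hFfin hEF).trans hc
      (fun n => (hCfin n).image f) hFfin hDfin hDF.symm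
  have hleft : ∀ g, AsympEq U (fun n => ((C n).ncard : ℝ)) C fun n => π (jG g) '' C n := by
    intro g
    rw [show ⇑(π (jG g)) = φ g from funext (hπ.left g)]
    exact AsympEq.mono (hC.2 g) hUtop
  have hright : ∀ h, AsympEq U (fun n => ((C n).ncard : ℝ)) C fun n => π (jH h) '' C n := by
    intro h
    have hDh : AsympEq atTop (fun n => ((D n).ncard : ℝ)) D fun n => ψ h '' D n := hD.2 h
    rw [hcD] at hDh
    have himg : ∀ n, f '' (π (jH h) '' C n) = ψ h '' (f '' C n) := fun n => by
      simp only [Set.image_image, hπ.right]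
    refine (asympEq_image_iff f).1 ?_
    simp only [himg]
    exact (hfCD.trans hc (fun n => (hCfin n).image f) hDfin (fun n => (hDfin n).image _)
      (hDh.mono hUtop)).trans hc (fun n => (hCfin n).image f) (fun n => (hDfin n).image _)
      (fun n => ((hCfin n).image f).image _) ((asympEq_image_iff (ψ h)).2 hfCD.symm)
  have hmul : ∀ q p, AsympEq U (fun n => ((C n).ncard : ℝ)) C (fun n => π q '' C n) →
      AsympEq U (fun n => ((C n).ncard : ℝ)) C (fun n => π p '' C n) →
      AsympEq U (fun n => ((C n).ncard : ℝ)) C fun n => π (q * p) '' C n := by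
    intro q p hq hp
    have himg : ∀ n, π (q * p) '' C n = π q '' (π p '' C n) := fun n => by
      rw [map_mul, Equiv.Perm.coe_mul, Set.image_comp]
    simp only [himg]
    exact hq.trans hc hCfin (fun n => (hCfin n).image _)
      (fun n => ((hCfin n).image _).image _) ((asympEq_image_iff (π q)).2 hp)
  refine amenableAction_of_asympEq U hCfin (fun n => (hC.1 n).2) fun p => ?_
  induction p using hP.induction with
  | one => simp [AsympEq]
  | left g p ih => exact hmul _ _ (hleft g) ih
  | right h p ih => exact hmul _ _ (hright h) ih

end Gluing

/-- Proposition 2.4 (Moon, arXiv:1003.3998): if `(G, H, A)` is in the class `𝒜'`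
then `G ∗_A H` is in the class `𝒜`.
Here `A` is a common finite subgroup of the countable groups `G` and `H` (given by
injective homomorphisms `iG`, `iH`), and the defining conditions of the class `𝒜'` are:
(i) a transitive `G`-action on a countable set `X`;
(ii) for `g ∈ G ∖ A` the set `{x ∈ X | Ax ∩ gAx = ∅}` is infinite, and similarly
for `h ∈ H ∖ A` on a countable `H`-set `Y`;
(iii) Følner sequences `C n ⊆ X`, `D n ⊆ Y` with `|C n| = |D n|` and with the
saturations `A • C n` (resp. `A • D n`) pairwise disjoint;
(iv) the restricted actions of `A` on `X` and on `Y` are free. -/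
theorem amalgam_of_classA'_triple_mem_classA
    (G H A : Type) [Group G] [Group H] [Group A]
    [Countable G] [Countable H] [Finite A]
    (iG : A →* G) (iH : A →* H)
    (hiG : Function.Injective iG) (hiH : Function.Injective iH)
    (X Y : Type) [Countable X] [Countable Y]
    (φ : G →* Equiv.Perm X) (ψ : H →* Equiv.Perm Y)
    (htrans : ∀ x y : X, ∃ g : G, φ g x = y)
    (hsuppG : ∀ g : G, g ∉ Set.range iG →
      {x : X | ∀ a b : A, φ (iG a) x ≠ φ g (φ (iG b) x)}.Infinite)
    (hsuppH : ∀ h : H, h ∉ Set.range iH →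
      {y : Y | ∀ a b : A, ψ (iH a) y ≠ ψ h (ψ (iH b) y)}.Infinite)
    (hFolner : ∃ (C : ℕ → Set X) (D : ℕ → Set Y),
      IsFolnerSeq φ C ∧ IsFolnerSeq ψ D ∧
      (∀ n, (C n).ncard = (D n).ncard) ∧
      (Pairwise fun m n =>
        Disjoint (⋃ a : A, φ (iG a) '' C m) (⋃ a : A, φ (iG a) '' C n)) ∧
      (Pairwise fun m n =>
        Disjoint (⋃ a : A, ψ (iH a) '' D m) (⋃ a : A, ψ (iH a) '' D n)))
    (hfreeX : ∀ (a : A) (x : X), φ (iG a) x = x → a = 1)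
    (hfreeY : ∀ (a : A) (y : Y), ψ (iH a) y = y → a = 1)
    (P : Type) [Group P] (jG : G →* P) (jH : H →* P)
    (hP : IsAmalgamatedProduct iG iH jG jH) :
    InClassA P := by
  obtain ⟨C, D, hC, hD, hCD, hCdisj, hDdisj⟩ := hFolner
  have hCsat : Pairwise fun m n =>
      Disjoint (saturation (φ.comp iG) (C m)) (saturation (φ.comp iG) (C n)) := hCdisj
  have hDsat : Pairwise fun m n =>
      Disjoint (saturation (ψ.comp iH) (D m)) (saturation (ψ.comp iH) (D n)) := hDdisj
  have : Infinite X :=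
    infinite_of_pairwise_disjoint hCsat fun n => saturation_nonempty _ (hC.1 n).2
  have : Infinite Y :=
    infinite_of_pairwise_disjoint hDsat fun n => saturation_nonempty _ (hD.1 n).2
  have : Countable P := hP.countable
  let 𝒟 : ℕ ⊕ {bp : Bool × P // IsReducedProduct iG iH jG jH bp.1 bp.2} → Set (X × Y) → Prop :=
    Sum.elim
      (fun N S => ∃ n ≥ N,
        (∀ x ∈ saturation (φ.comp iG) (C n), ∃ y ∈ saturation (ψ.comp iH) (D n), (x, y) ∈ S) ∨
        (∀ y ∈ saturation (ψ.comp iH) (D n), ∃ x ∈ saturation (φ.comp iG) (C n), (x, y) ∈ S))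
      (fun bp S => (bp.1.1 = true → ForcesOutOfDomain jG jH φ ψ bp.1.2 S) ∧
        (bp.1.1 = false → ForcesOutOfRange jG jH φ ψ bp.1.2 S))
  have h𝒟 : ∀ i R, IsPartialEquivariant (φ.comp iG) (ψ.comp iH) R →
      ∃ S, IsPartialEquivariant (φ.comp iG) (ψ.comp iH) S ∧ R ⊆ S ∧ 𝒟 i S := by
    rintro (N | ⟨bp, hbp⟩) R hR
    · obtain ⟨n, hn, hCn, hDn⟩ := ((Filter.eventually_ge_atTop N).and
        ((eventually_disjoint_of_pairwise_disjoint hCsat (hR.finite.image Prod.fst)).and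
        (eventually_disjoint_of_pairwise_disjoint hDsat (hR.finite.image Prod.snd)))).exists
      obtain ⟨S, hS, hRS, h⟩ := hR.exists_matching hfreeX hfreeY
        (saturation_finite _ (hC.1 n).1) (saturation_finite _ (hD.1 n).1)
        (apply_mem_saturation _) (apply_mem_saturation _) hCn hDn
      exact ⟨S, hS, hRS, n, hn, h⟩
    · exact hbp.exists_forces hsuppG hsuppH hfreeX hfreeY hR
  obtain ⟨f, hf, hf𝒟⟩ := exists_equivariant_equiv hfreeX hfreeY 𝒟 h𝒟
  obtain ⟨π, ⟨hπG, hπH⟩, -⟩ := hP.2 (Equiv.Perm X) φ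
    ((f.symm.permCongrHom : Equiv.Perm Y →* Equiv.Perm X).comp ψ) (by
      ext a x
      exact f.injective (by simpa using hf a x))
  have hπ : IsGluedAction jG jH φ ψ f π := by
    refine ⟨fun g x => ?_, fun h x => ?_⟩
    · rw [← hπG]; rfl
    · rw [← MonoidHom.comp_apply, hπH]; simp
  refine ⟨X, inferInstance, π, ?_, fun x y => ?_, ?_⟩
  · refine (injective_iff_map_eq_one π).2 fun p hp => ?_
    rcases hP.mem_base_or_isReducedProduct p with ⟨a, rfl⟩ | ⟨b, hb⟩
    · obtain ⟨x⟩ : Nonempty X := inferInstance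
      have hax := hπ.left (iG a) x
      rw [hp, Equiv.Perm.one_apply] at hax
      simp [hfreeX a x hax.symm]
    · obtain ⟨S, -, ⟨hdom, hran⟩, hfS⟩ := hf𝒟 (Sum.inr ⟨(b, p), hb⟩)
      cases b
      · exact absurd hp ((hran rfl).ne_one hπ hfS)
      · exact absurd hp ((hdom rfl).ne_one hπ hfS)
  · obtain ⟨g, rfl⟩ := htrans x y
    exact ⟨jG g, hπ.left g x⟩
  · refine amenableAction_of_frequently_nested hP hπ hC hD hCD
      (Filter.frequently_atTop.2 fun N => ?_)
    obtain ⟨S, -, ⟨n, hn, h⟩, hfS⟩ := hf𝒟 (Sum.inl N)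
    refine ⟨n, hn, h.imp (fun h => ?_) fun h y hy => ?_⟩
    · rintro _ ⟨x, hx, rfl⟩
      obtain ⟨y, hy, hxy⟩ := h x hx
      rwa [hfS x y hxy]
    · obtain ⟨x, hx, hxy⟩ := h y hy
      exact ⟨x, hx, hfS x y hxy⟩
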